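/- Let 0 ≤ p < γ < γ' with γ + γ' > 1, and suppose W_{X,γ,p}(s,t) and W_{h,γ',p}(s,t) are finite controls for paths X and h. Then the Young integral cross-iterated integral ∫_s^t (δh)_{s,u} ⊗ d X_u exists, and satisfies |∫_{τ_1}^{τ_2} (δh)_{τ_1,u} ⊗ dX_u| ≲ (τ_2-τ_1)^{2p} · W_{X,γ,p}(τ_1,τ_2)^{γ-p} · W_{h,γ',p}(τ_1,τ_2)^{γ'-p} for all [τ_1,τ_2] ⊆ [s,t]. -/

import Mathlib

open scoped ENNReal

/-- The partition sum `∑_k |g(τ_k, τ_{k+1})|^e / (τ_{k+1} - τ k)^q`. -/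
noncomputable def pSum (g : ℝ → ℝ → ℝ) (e q : ℝ) (m : ℕ) (τ : ℕ → ℝ) : ℝ :=
  ∑ k ∈ Finset.range m, |g (τ k) (τ (k + 1))| ^ e / (τ (k + 1) - τ k) ^ q

/-- The partition-supremum control of a two-parameter function `g` over `[s,t]`. -/
noncomputable def pCtrl (g : ℝ → ℝ → ℝ) (e q s t : ℝ) : ℝ≥0∞ :=
  ⨆ (m : ℕ) (τ : ℕ → ℝ)
    (_ : τ 0 = s ∧ τ m = t ∧ ∀ k < m, τ k < τ (k + 1)),
    ENNReal.ofReal (pSum g e q m τ)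

lemma yc_remove (G : ℝ → ℝ → ℝ) (τ : ℕ → ℝ) (i r : ℕ) :
    ∑ k ∈ Finset.range (i + 2 + r), G (τ k) (τ (k + 1)) =
      ∑ k ∈ Finset.range (i + 1 + r),
        G (if k ≤ i then τ k else τ (k + 1)) (if k + 1 ≤ i then τ (k + 1) else τ (k + 1 + 1))
      + (G (τ i) (τ (i + 1)) + G (τ (i + 1)) (τ (i + 2)) - G (τ i) (τ (i + 2))) := by
  induction r with
  | zero =>
    have h : ∑ k ∈ Finset.range i,
        G (if k ≤ i then τ k else τ (k + 1)) (if k + 1 ≤ i then τ (k + 1) else τ (k + 1 + 1))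
        = ∑ k ∈ Finset.range i, G (τ k) (τ (k + 1)) := by
      apply Finset.sum_congr rfl
      intro k hk
      have hk' := Finset.mem_range.1 hk
      rw [if_pos hk'.le, if_pos (by omega)]
    simp only [add_zero]
    rw [Finset.sum_range_succ, Finset.sum_range_succ, Finset.sum_range_succ, h,
      if_pos le_rfl, if_neg (by omega)]
    ring_nf
  | succ r ih =>
    rw [← add_assoc, ← add_assoc, Finset.sum_range_succ, ih, Finset.sum_range_succ _ (i + 1 + r),
      if_neg (by omega), if_neg (by omega)]
    have e : i + 1 + r + 1 = i + 2 + r := by omega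
    rw [e]
    ring

lemma yc_small {n : ℕ} (a : ℕ → ℝ) (A : ℝ) (ha : ∀ k < n, 0 ≤ a k)
    (hs : ∑ k ∈ Finset.range n, a k ≤ A) {k : ℕ} (hk : k < n) (h : a k / A ≤ 4 / n) :
    a k ≤ 4 * A / n := by
  have h1 : a k ≤ A := le_trans (Finset.single_le_sum (f := a)
    (fun i hi => ha i (Finset.mem_range.1 hi)) (Finset.mem_range.2 hk)) hs
  rcases eq_or_lt_of_le ((ha k hk).trans h1) with hA | hA
  · subst hA; simpa using h1
  · rw [div_le_iff₀ hA] at h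
    calc a k ≤ _ := h
      _ = _ := by ring

lemma yc_norm {n : ℕ} (a : ℕ → ℝ) (A : ℝ) (hA : 0 ≤ A)
    (hs : ∑ k ∈ Finset.range n, a k ≤ A) : ∑ k ∈ Finset.range n, a k / A ≤ 1 := by
  rw [← Finset.sum_div]
  exact div_le_one_of_le₀ hs hA

lemma yc_pigeon {n : ℕ} (hn : 0 < n) (a b c e : ℕ → ℝ) (A B C E : ℝ)
    (ha : ∀ k < n, 0 ≤ a k) (hb : ∀ k < n, 0 ≤ b k) (hc : ∀ k < n, 0 ≤ c k)
    (he : ∀ k < n, 0 ≤ e k)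
    (hA : ∑ k ∈ Finset.range n, a k ≤ A) (hB : ∑ k ∈ Finset.range n, b k ≤ B)
    (hC : ∑ k ∈ Finset.range n, c k ≤ C) (hE : ∑ k ∈ Finset.range n, e k ≤ E) :
    ∃ k < n, a k ≤ 4 * A / n ∧ b k ≤ 4 * B / n ∧ c k ≤ 4 * C / n ∧ e k ≤ 4 * E / n := by
  have nn : ∀ (a : ℕ → ℝ) (A : ℝ), (∀ k < n, 0 ≤ a k) → ∑ k ∈ Finset.range n, a k ≤ A → 0 ≤ A :=
    fun a A ha hA => (Finset.sum_nonneg (fun i hi => ha i (Finset.mem_range.1 hi))).trans hA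
  have nA := nn a A ha hA
  have nB := nn b B hb hB
  have nC := nn c C hc hC
  have nE := nn e E he hE
  have hsum : ∑ k ∈ Finset.range n, (a k / A + b k / B + c k / C + e k / E)
      ≤ ∑ k ∈ Finset.range n, (4 / n : ℝ) := by
    simp only [Finset.sum_add_distrib]
    have hn' : (n : ℝ) ≠ 0 := by positivity
    have : ∑ k ∈ Finset.range n, (4 / n : ℝ) = 4 := by
      simp; field_simp
    rw [this]
    linarith [yc_norm a A nA hA, yc_norm b B nB hB, yc_norm c C nC hC, yc_norm e E nE hE]
  obtain ⟨k, hk, hle⟩ := Finset.exists_le_of_sum_le (Finset.nonempty_range_iff.2 hn.ne') hsum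
  have hk' := Finset.mem_range.1 hk
  have p1 := div_nonneg (ha k hk') nA
  have p2 := div_nonneg (hb k hk') nB
  have p3 := div_nonneg (hc k hk') nC
  have p4 := div_nonneg (he k hk') nE
  exact ⟨k, hk', yc_small a A ha hA hk' (by linarith), yc_small b B hb hB hk' (by linarith),
    yc_small c C hc hC hk' (by linarith), yc_small e E he hE hk' (by linarith)⟩

lemma yc_point {x D a p A L : ℝ} {n : ℕ} (hx : 0 ≤ x) (hD : 0 < D) (hp : 0 ≤ p) (ha : p < a)
    (hL : 0 ≤ L) (hA : 0 ≤ A)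
    (h1 : x ^ (1 / (a - p)) / D ^ (p / (a - p)) ≤ 4 * A / n) (h2 : D ≤ 4 * L / n) :
    x ≤ (4 / n : ℝ) ^ a * A ^ (a - p) * L ^ p := by
  have hap : 0 < a - p := by linarith
  have e : x = (x ^ (1 / (a - p)) / D ^ (p / (a - p))) ^ (a - p) * D ^ p := by
    rw [Real.div_rpow (by positivity) (by positivity), ← Real.rpow_mul hx, ← Real.rpow_mul hD.le,
      one_div_mul_cancel hap.ne', div_mul_cancel₀ _ hap.ne', Real.rpow_one,
      div_mul_cancel₀ _ (by positivity)]
  have hn : (0:ℝ) ≤ 4 / n := by positivity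
  have hn0 : (0:ℝ) < 4 / n := by
    rcases Nat.eq_zero_or_pos n with rfl | h
    · simp at h2; linarith
    · positivity
  calc x = _ := e
    _ ≤ (4 * A / n) ^ (a - p) * (4 * L / n) ^ p := by gcongr
    _ = (4 / n * A) ^ (a - p) * (4 / n * L) ^ p := by ring_nf
    _ = ((4 / n : ℝ) ^ (a - p) * (4 / n : ℝ) ^ p) * A ^ (a - p) * L ^ p := by
      rw [Real.mul_rpow hn hA, Real.mul_rpow hn hL]; ring
    _ = _ := by rw [← Real.rpow_add hn0]; ring_nf

lemma yc_max (f g : ℝ → ℝ) (H X : ℝ → ℝ → ℝ) (γ γ' p a b W V : ℝ)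
    (hp0 : 0 ≤ p) (hpγ : p < γ) (hpγ' : p < γ')
    (hf : ∀ u v, |f v - f u| ≤ |H u v|) (hg : ∀ u v, |g v - g u| ≤ |X u v|)
    (hW : ∀ (m : ℕ) (τ : ℕ → ℝ), (τ 0 = a ∧ τ m = b ∧ ∀ k < m, τ k < τ (k + 1)) →
      pSum X (1 / (γ - p)) (p / (γ - p)) m τ ≤ W)
    (hV : ∀ (m : ℕ) (τ : ℕ → ℝ), (τ 0 = a ∧ τ m = b ∧ ∀ k < m, τ k < τ (k + 1)) →
      pSum H (1 / (γ' - p)) (p / (γ' - p)) m τ ≤ V)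
    (hab : a ≤ b) (hW0 : 0 ≤ W) (hV0 : 0 ≤ V)
    (m : ℕ) : ∀ (τ : ℕ → ℝ), (τ 0 = a ∧ τ m = b ∧ ∀ k < m, τ k < τ (k + 1)) →
    |∑ k ∈ Finset.range m, f (τ k) * (g (τ (k + 1)) - g (τ k)) - f a * (g b - g a)| ≤
      (∑ n ∈ Finset.range m, 1 / (n : ℝ) ^ (γ + γ')) *
        ((4:ℝ) ^ (γ + γ') * (b - a) ^ (2 * p) * W ^ (γ - p) * V ^ (γ' - p)) := by
  have hL : 0 ≤ b - a := by linarith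
  induction m with
  | zero => rintro τ ⟨h0, h1, -⟩; simp [← h0, ← h1]
  | succ n ih =>
    rintro τ ⟨h0, h1, h2⟩
    rcases Nat.eq_zero_or_pos n with rfl | hn
    · have h1' : τ 1 = b := h1
      simp [h0, h1']
      positivity
    have dpos : ∀ k < n + 1, 0 < τ (k + 1) - τ k := fun k hk => by linarith [h2 k hk]
    have hsW := hW _ τ ⟨h0, h1, h2⟩
    have hsV := hV _ τ ⟨h0, h1, h2⟩
    have hsL : ∑ k ∈ Finset.range (n + 1), (τ (k + 1) - τ k) = b - a := by
      rw [Finset.sum_range_sub, h0, h1]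
    have hsL' := hsL
    unfold pSum at hsW hsV
    rw [Finset.sum_range_succ'] at hsW hsL'
    rw [Finset.sum_range_succ] at hsV hsL
    have tn : ∀ (Y : ℝ → ℝ → ℝ) (e q : ℝ), ∀ k < n + 1,
        0 ≤ |Y (τ k) (τ (k + 1))| ^ e / (τ (k + 1) - τ k) ^ q := fun Y e q k hk => by
      have := dpos k hk
      positivity
    obtain ⟨i, hi, q1, q2, q3, q4⟩ := yc_pigeon hn
      (fun k => |X (τ (k + 1)) (τ (k + 1 + 1))| ^ (1 / (γ - p)) /
        (τ (k + 1 + 1) - τ (k + 1)) ^ (p / (γ - p)))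
      (fun k => |H (τ k) (τ (k + 1))| ^ (1 / (γ' - p)) / (τ (k + 1) - τ k) ^ (p / (γ' - p)))
      (fun k => τ (k + 1 + 1) - τ (k + 1)) (fun k => τ (k + 1) - τ k) W V (b - a) (b - a)
      (fun k hk => tn _ _ _ (k + 1) (by omega)) (fun k hk => tn _ _ _ k (by omega))
      (fun k hk => (dpos (k + 1) (by omega)).le) (fun k hk => (dpos k (by omega)).le)
      (by linarith [tn X (1 / (γ - p)) (p / (γ - p)) 0 (by omega)])
      (by linarith [tn H (1 / (γ' - p)) (p / (γ' - p)) n (by omega)])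
      (by linarith [dpos 0 (by omega)]) (by linarith [dpos n (by omega)])
    have b1 := yc_point (abs_nonneg _) (dpos (i + 1) (by omega)) hp0 hpγ hL hW0 q1 q3
    have b2 := yc_point (abs_nonneg _) (dpos i (by omega)) hp0 hpγ' hL hV0 q2 q4
    obtain ⟨r, rfl⟩ : ∃ r, n = i + 1 + r := ⟨n - (i + 1), by omega⟩
    have hrem := yc_remove (fun u v => f u * (g v - g u)) τ i r
    have hI := ih (fun k => if k ≤ i then τ k else τ (k + 1)) ⟨by simp [h0], by
        rw [if_neg (by omega)]; exact h1, by
        intro k hk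
        split_ifs with c1 c2 c2
        · exact h2 k (by omega)
        · have : k = i := by omega
          subst this
          exact (h2 k (by omega)).trans (h2 (k + 1) (by omega))
        · omega
        · exact h2 (k + 1) (by omega)⟩
    have e : i + 1 + r + 1 = i + 2 + r := by omega
    rw [e, hrem, ← e, Finset.sum_range_succ (fun n : ℕ => 1 / (n : ℝ) ^ (γ + γ'))]
    set N : ℕ := i + 1 + r with hN
    have hNpos : (0:ℝ) < N := by exact_mod_cast hn
    have key : |(f (τ (i + 1)) - f (τ i)) * (g (τ (i + 2)) - g (τ (i + 1)))| ≤
        1 / (N : ℝ) ^ (γ + γ') *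
        ((4:ℝ) ^ (γ + γ') * (b - a) ^ (2 * p) * W ^ (γ - p) * V ^ (γ' - p)) := by
      rw [abs_mul]
      have hLp : (b - a) ^ (2 * p) = (b - a) ^ p * (b - a) ^ p := by
        have hLpos : 0 < b - a := by
          have := dpos i (by omega)
          have h3 := lt_of_lt_of_le this q4
          by_contra hc
          have : b - a = 0 := by linarith
          rw [this] at h3; simp at h3
        rw [two_mul, Real.rpow_add hLpos]
      calc _ ≤ ((4 / N : ℝ) ^ γ' * V ^ (γ' - p) * (b - a) ^ p) *
            ((4 / N : ℝ) ^ γ * W ^ (γ - p) * (b - a) ^ p) :=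
            mul_le_mul ((hf _ _).trans b2) ((hg _ _).trans b1) (abs_nonneg _) (by positivity)
        _ = ((4 / N : ℝ) ^ γ * (4 / N : ℝ) ^ γ') * ((b - a) ^ p * (b - a) ^ p) *
              W ^ (γ - p) * V ^ (γ' - p) := by ring
        _ = _ := by
          rw [← Real.rpow_add (by positivity), ← hLp, Real.div_rpow (by norm_num) hNpos.le]
          ring
    rw [add_mul]
    refine le_trans ?_ (add_le_add hI key)
    refine le_trans (le_of_eq ?_) (abs_add_le _ _)
    congr 1
    ring

lemma yc_le_toReal {g : ℝ → ℝ → ℝ} {e q a b : ℝ} (hfin : pCtrl g e q a b ≠ ⊤)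
    (m : ℕ) (τ : ℕ → ℝ) (hτ : τ 0 = a ∧ τ m = b ∧ ∀ k < m, τ k < τ (k + 1)) :
    pSum g e q m τ ≤ (pCtrl g e q a b).toReal := by
  rw [← ENNReal.ofReal_le_iff_le_toReal hfin]
  unfold pCtrl
  exact le_iSup_of_le m (le_iSup_of_le τ (le_iSup_of_le hτ le_rfl))

lemma yc_mono_left (g : ℝ → ℝ → ℝ) (e q : ℝ) {s a b : ℝ} (h : s ≤ a) :
    pCtrl g e q a b ≤ pCtrl g e q s b := by
  rcases eq_or_lt_of_le h with rfl | h
  · rfl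
  conv_lhs => unfold pCtrl
  refine iSup_le fun m => iSup_le fun τ => iSup_le fun hτ => ?_
  obtain ⟨h0, h1, h2⟩ := hτ
  let σ : ℕ → ℝ := fun k => Nat.casesOn k s τ
  have hσ : σ 0 = s ∧ σ (m + 1) = b ∧ ∀ k < m + 1, σ k < σ (k + 1) := by
    refine ⟨rfl, h1, ?_⟩
    intro k hk
    cases k with
    | zero => show s < τ 0; rw [h0]; exact h
    | succ k => exact h2 k (by omega)
  have : ENNReal.ofReal (pSum g e q (m + 1) σ) ≤ pCtrl g e q s b := by
    unfold pCtrl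
    exact le_iSup_of_le (m + 1) (le_iSup_of_le σ (le_iSup_of_le hσ le_rfl))
  refine le_trans (ENNReal.ofReal_le_ofReal ?_) this
  unfold pSum
  rw [Finset.sum_range_succ' _ m]
  have hd : 0 < σ (0 + 1) - σ 0 := by linarith [hσ.2.2 0 (by omega)]
  have : 0 ≤ |g (σ 0) (σ (0 + 1))| ^ e / (σ (0 + 1) - σ 0) ^ q := by positivity
  exact le_add_of_nonneg_right this

lemma yc_mono_right (g : ℝ → ℝ → ℝ) (e q : ℝ) {a b t : ℝ} (h : b ≤ t) :
    pCtrl g e q a b ≤ pCtrl g e q a t := by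
  rcases eq_or_lt_of_le h with rfl | h
  · rfl
  conv_lhs => unfold pCtrl
  refine iSup_le fun m => iSup_le fun τ => iSup_le fun hτ => ?_
  obtain ⟨h0, h1, h2⟩ := hτ
  let σ : ℕ → ℝ := fun k => if k ≤ m then τ k else t
  have hs : ∀ k ≤ m, σ k = τ k := fun k hk => if_pos hk
  have hs' : σ (m + 1) = t := if_neg (by omega)
  have hσ : σ 0 = a ∧ σ (m + 1) = t ∧ ∀ k < m + 1, σ k < σ (k + 1) := by
    refine ⟨by rw [hs 0 (by omega), h0], hs', ?_⟩
    intro k hk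
    rcases Nat.lt_or_ge k m with hk' | hk'
    · rw [hs k (by omega), hs (k + 1) (by omega)]; exact h2 k hk'
    · have : k = m := by omega
      subst this
      rw [hs', hs k le_rfl, h1]; exact h
  have : ENNReal.ofReal (pSum g e q (m + 1) σ) ≤ pCtrl g e q a t := by
    unfold pCtrl
    exact le_iSup_of_le (m + 1) (le_iSup_of_le σ (le_iSup_of_le hσ le_rfl))
  refine le_trans (ENNReal.ofReal_le_ofReal ?_) this
  unfold pSum
  rw [Finset.sum_range_succ _ m]
  have hd : 0 < σ (m + 1) - σ m := by linarith [hσ.2.2 m (by omega)]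
  have h3 : 0 ≤ |g (σ m) (σ (m + 1))| ^ e / (σ (m + 1) - σ m) ^ q := by positivity
  refine le_trans (le_of_eq ?_) (le_add_of_nonneg_right h3)
  refine Finset.sum_congr rfl fun k hk => ?_
  have hk' := Finset.mem_range.1 hk
  rw [hs k (by omega), hs (k + 1) (by omega)]

lemma yc_enum (F : Finset ℝ) : ∃ σ : ℕ → ℝ, ∃ r : ℝ → ℕ,
    (∀ x ∈ F, σ (r x) = x) ∧ (∀ i j, i < j → j < F.card → σ i < σ j) ∧ ∀ x ∈ F, r x < F.card := by
  let σ : ℕ → ℝ := fun k => if h : k < F.card then F.orderEmbOfFin rfl ⟨k, h⟩ else 0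
  have hex : ∀ x : ℝ, ∃ i : ℕ, x ∈ F → σ i = x ∧ i < F.card := by
    intro x
    by_cases hx : x ∈ F
    · have : x ∈ Set.range (F.orderEmbOfFin rfl) := by
        rw [Finset.range_orderEmbOfFin]; exact hx
      obtain ⟨i, hi⟩ := this
      refine ⟨i, fun _ => ⟨?_, i.2⟩⟩
      simp only [σ, dif_pos i.2]
      exact hi
    · exact ⟨0, fun h => absurd h hx⟩
  choose r hr using hex
  refine ⟨σ, r, fun x hx => (hr x hx).1, ?_, fun x hx => (hr x hx).2⟩
  intro i j hij hj
  simp only [σ, dif_pos hj, dif_pos (hij.trans hj)]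
  exact (F.orderEmbOfFin rfl).strictMono hij

/-- Uniform finite-partition version. -/
lemma yc_finite (f g : ℝ → ℝ) (bd : ℝ → ℝ → ℝ) (s t : ℝ)
    (hbd : ∀ a b, s ≤ a → a ≤ b → b ≤ t → ∀ (m : ℕ) (τ : ℕ → ℝ),
      (τ 0 = a ∧ τ m = b ∧ ∀ k < m, τ k < τ (k + 1)) →
      |∑ k ∈ Finset.range m, f (τ k) * (g (τ (k + 1)) - g (τ k)) - f a * (g b - g a)| ≤ bd a b)
    (F : Finset ℝ) : ∃ J : ℝ → ℝ, ∀ a ∈ F, ∀ b ∈ F, s ≤ a → a ≤ b → b ≤ t →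
      |J b - J a - f a * (g b - g a)| ≤ bd a b := by
  obtain ⟨σ, r, h1, h2, h3⟩ := yc_enum F
  refine ⟨fun x => ∑ k ∈ Finset.range (r x), f (σ k) * (g (σ (k + 1)) - g (σ k)), ?_⟩
  intro a ha b hb hsa hab hbt
  have hr : r a ≤ r b := by
    by_contra hc
    push Not at hc
    have := h2 _ _ hc (h3 a ha)
    rw [h1 a ha, h1 b hb] at this
    linarith
  obtain ⟨m, hm⟩ := Nat.exists_eq_add_of_le hr
  have := hbd a b hsa hab hbt m (fun k => σ (r a + k)) ⟨by simpa using h1 a ha, by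
    simp only [← hm]; exact h1 b hb, fun k hk => h2 _ _ (by omega) (by
      have := h3 b hb; omega)⟩
  dsimp only
  rw [hm, Finset.sum_range_add, add_sub_cancel_left]
  exact this

lemma yc_limit (f g : ℝ → ℝ) (bd : ℝ → ℝ → ℝ) (s t : ℝ)
    (hfin : ∀ F : Finset ℝ, ∃ J : ℝ → ℝ, ∀ a ∈ F, ∀ b ∈ F, s ≤ a → a ≤ b → b ≤ t →
      |J b - J a - f a * (g b - g a)| ≤ bd a b) :
    ∃ B : ℝ → ℝ → ℝ,
      (∀ a b c, s ≤ a → a ≤ b → b ≤ c → c ≤ t →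
        B a c = B a b + B b c + (f b - f a) * (g c - g b)) ∧
      (∀ a b, s ≤ a → a ≤ b → b ≤ t → |B a b| ≤ bd a b) := by
  choose J hJ using hfin
  let U : Ultrafilter (Finset ℝ) := Ultrafilter.of Filter.atTop
  have hU : (U : Filter (Finset ℝ)) ≤ Filter.atTop := Ultrafilter.of_le _
  let Q : ℝ → ℝ → Finset ℝ → ℝ := fun a b F => J F b - J F a - f a * (g b - g a)
  have hex : ∀ a b, ∃ l : ℝ, (s ≤ a → a ≤ b → b ≤ t →
      Filter.Tendsto (Q a b) U (nhds l) ∧ |l| ≤ bd a b) := by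
    intro a b
    by_cases hc : s ≤ a ∧ a ≤ b ∧ b ≤ t
    · obtain ⟨c1, c2, c3⟩ := hc
      have hev : ∀ᶠ F in (U : Filter (Finset ℝ)), Q a b F ∈ Set.Icc (-bd a b) (bd a b) := by
        apply hU
        filter_upwards [Filter.eventually_ge_atTop ({a, b} : Finset ℝ)] with F hF
        exact abs_le.1 (hJ F a (hF (by simp)) b (hF (by simp)) c1 c2 c3)
      have := (isCompact_Icc (a := -bd a b) (b := bd a b)).ultrafilter_le_nhds (U.map (Q a b))
        (by rw [Filter.le_principal_iff]; exact hev)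
      obtain ⟨l, hl, hle⟩ := this
      exact ⟨l, fun _ _ _ => ⟨hle, abs_le.2 hl⟩⟩
    · exact ⟨0, fun c1 c2 c3 => absurd ⟨c1, c2, c3⟩ hc⟩
  choose B hB using hex
  refine ⟨B, ?_, fun a b h1 h2 h3 => (hB a b h1 h2 h3).2⟩
  intro a b c h1 h2 h3 h4
  have t1 := (hB a c h1 (h2.trans h3) h4).1
  have t2 := (hB a b h1 h2 (h3.trans h4)).1
  have t3 := (hB b c (h1.trans h2) h3 h4).1
  refine tendsto_nhds_unique t1 (((t2.add t3).add_const _).congr fun F => ?_)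
  simp only [Q]
  ring

/-- Existence of the cross-iterated Young integral `B_{τ₁,τ₂} = ∫ (δh) ⊗ dX`:
for `0 ≤ p < γ < γ'` with `γ + γ' > 1` and finite controls, there exists a
second-level object `B` satisfying Chen's relation
`B_{τ₁,τ₃} = B_{τ₁,τ₂} + B_{τ₂,τ₃} + (δh)_{τ₁,τ₂} ⊗ (δX)_{τ₂,τ₃}` and the
Young–Lóeve bound
`|B_{τ₁,τ₂}| ≲ (τ₂-τ₁)^{2p} W_{X,γ,p}(τ₁,τ₂)^{γ-p} W_{h,γ',p}(τ₁,τ₂)^{γ'-p}`. -/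
theorem young_cross_integral_exists (d : ℕ)
    (X h : ℝ → EuclideanSpace ℝ (Fin d)) (γ γ' p s t : ℝ)
    (hp0 : 0 ≤ p) (hpγ : p < γ) (hγγ' : γ < γ') (hyoung : 1 < γ + γ') (hst : s ≤ t)
    (hXfin : pCtrl (fun u v => ‖X v - X u‖) (1 / (γ - p)) (p / (γ - p)) s t ≠ ⊤)
    (hhfin : pCtrl (fun u v => ‖h v - h u‖) (1 / (γ' - p)) (p / (γ' - p)) s t ≠ ⊤) :
    ∃ B : ℝ → ℝ → Fin d → Fin d → ℝ, ∃ C : ℝ, 0 < C ∧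
      (∀ τ1 τ2 τ3 : ℝ, s ≤ τ1 → τ1 ≤ τ2 → τ2 ≤ τ3 → τ3 ≤ t → ∀ i j : Fin d,
        B τ1 τ3 i j = B τ1 τ2 i j + B τ2 τ3 i j + (h τ2 i - h τ1 i) * (X τ3 j - X τ2 j)) ∧
      (∀ τ1 τ2 : ℝ, s ≤ τ1 → τ1 ≤ τ2 → τ2 ≤ t → ∀ i j : Fin d,
        |B τ1 τ2 i j| ≤ C * (τ2 - τ1) ^ (2 * p) *
          ((pCtrl (fun u v => ‖X v - X u‖) (1 / (γ - p)) (p / (γ - p)) τ1 τ2).toReal) ^ (γ - p) *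
          ((pCtrl (fun u v => ‖h v - h u‖) (1 / (γ' - p)) (p / (γ' - p)) τ1 τ2).toReal) ^ (γ' - p)) := by
  have hpγ' : p < γ' := hpγ.trans hγγ'
  have hsum : Summable (fun n : ℕ => 1 / (n : ℝ) ^ (γ + γ')) :=
    Real.summable_one_div_nat_rpow.2 hyoung
  set Z : ℝ := ∑' n : ℕ, 1 / (n : ℝ) ^ (γ + γ') with hZ
  have hZ0 : 0 ≤ Z := tsum_nonneg fun n => by positivity
  set WX := fun a b => (pCtrl (fun u v => ‖X v - X u‖) (1 / (γ - p)) (p / (γ - p)) a b).toReal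
    with hWX
  set WH := fun a b => (pCtrl (fun u v => ‖h v - h u‖) (1 / (γ' - p)) (p / (γ' - p)) a b).toReal
    with hWH
  have hij : ∀ i j : Fin d, ∃ B : ℝ → ℝ → ℝ,
      (∀ a b c, s ≤ a → a ≤ b → b ≤ c → c ≤ t →
        B a c = B a b + B b c + (h b i - h a i) * (X c j - X b j)) ∧
      (∀ a b, s ≤ a → a ≤ b → b ≤ t → |B a b| ≤ (Z + 1) *
        ((4:ℝ) ^ (γ + γ') * (b - a) ^ (2 * p) * (WX a b) ^ (γ - p) * (WH a b) ^ (γ' - p))) := by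
    intro i j
    refine yc_limit (fun u => h u i) (fun u => X u j) _ s t
      (yc_finite (fun u => h u i) (fun u => X u j) _ s t ?_)
    intro a b hsa hab hbt m τ hτ
    have finX := ne_top_of_le_ne_top hXfin
      ((yc_mono_right _ _ _ hbt).trans (yc_mono_left _ _ _ hsa))
    have finH := ne_top_of_le_ne_top hhfin
      ((yc_mono_right _ _ _ hbt).trans (yc_mono_left _ _ _ hsa))
    have hc : ∀ (Y : ℝ → EuclideanSpace ℝ (Fin d)) (l : Fin d) (u v : ℝ),
        |Y v l - Y u l| ≤ |‖Y v - Y u‖| := by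
      intro Y l u v
      rw [abs_of_nonneg (norm_nonneg (Y v - Y u))]
      have := PiLp.norm_apply_le (Y v - Y u) l
      simpa using this
    have hb : 0 ≤ b - a := by linarith
    refine (yc_max (fun u => h u i) (fun u => X u j) (fun u v => ‖h v - h u‖)
      (fun u v => ‖X v - X u‖) γ γ' p a b (WX a b) (WH a b) hp0 hpγ hpγ' (hc h i) (hc X j)
      (yc_le_toReal finX) (yc_le_toReal finH) hab ENNReal.toReal_nonneg ENNReal.toReal_nonneg
      m τ hτ).trans ?_
    have hWa : 0 ≤ WX a b := ENNReal.toReal_nonneg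
    have hWb : 0 ≤ WH a b := ENNReal.toReal_nonneg
    refine mul_le_mul_of_nonneg_right ?_ (by positivity)
    have := hsum.sum_le_tsum (Finset.range m) (fun n _ => by positivity)
    linarith
  choose B hB1 hB2 using hij
  refine ⟨fun a b i j => B i j a b, (Z + 1) * (4:ℝ) ^ (γ + γ'), by positivity, ?_, ?_⟩
  · intro a b c h1 h2 h3 h4 i j
    exact hB1 i j a b c h1 h2 h3 h4
  · intro a b h1 h2 h3 i j
    refine (hB2 i j a b h1 h2 h3).trans (le_of_eq ?_)
    simp only [hWX, hWH]
    ring
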